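/- Let σ be a positive 3-form at a point p of a 7-manifold, with induced inner product and Hodge star *. Every 3-form γ ∈ Λ³T*_pM decomposes uniquely as γ = f⁰σ + *(f¹∧σ) + f³ with f⁰ ∈ ℝ, f¹ ∈ T*_pM and f³ in the 27-dimensional component Λ³₂₇. Then f⁰ = (1/7)(γ·σ), f¹ = −(1/4) σ ⌐ (*γ), and f³ = γ − f⁰σ − *(f¹∧σ). Equivalently, the orthogonal projections satisfy π³₁γ = (1/7)(γ·σ)σ and π³₇γ = −(1/4)*((σ ⌐ (*γ))∧σ). -/

import Mathlib

/-!
Statement 6: the `G₂`-irreducible decomposition `γ = f⁰σ + *(f¹∧σ) + f³` of a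
3-form, with `f³ ∈ Λ³₂₇`, exists and is unique, and
`f⁰ = (1/7) γ·σ`, `f¹ = −(1/4) σ ⌐ (*γ)`, `f³ = γ − f⁰σ − *(f¹∧σ)`.
-/

noncomputable section

namespace G2Point

/-- The model space `ℝ⁷`. -/
abbrev E7 : Type := EuclideanSpace ℝ (Fin 7)

/-- Alternating `k`-forms on `V`. -/
abbrev FormAt (V : Type) [AddCommGroup V] [Module ℝ V] (k : ℕ) :=
  AlternatingMap ℝ V ℝ (Fin k)

/-- The `i`-th coordinate functional on `ℝ⁷`. -/
def coord (i : Fin 7) : E7 →ₗ[ℝ] ℝ :=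
  LinearMap.proj i ∘ₗ (WithLp.linearEquiv 2 ℝ (Fin 7 → ℝ)).toLinearMap

/-- The wedge `e^a ∧ e^b ∧ e^c` of coordinate covectors on `ℝ⁷`
(determinant convention). -/
def e3 (a b c : Fin 7) : FormAt E7 3 :=
  (Matrix.detRowAlternating (R := ℝ) (n := Fin 3)).compLinearMap
    (LinearMap.pi ![coord a, coord b, coord c])

/-- The standard `G₂` 3-form on `ℝ⁷`. -/
def stdG2 : FormAt E7 3 :=
  e3 0 1 2 + e3 0 3 4 + e3 0 5 6 + e3 1 3 5 - e3 1 4 6 - e3 2 3 6 - e3 2 4 5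

variable {V : Type} [AddCommGroup V] [Module ℝ V]

/-- A 3-form on `V` is *positive* if it is the pullback of the standard `G₂`
3-form under some linear isomorphism `V ≃ ℝ⁷`. -/
def IsPositive (σ : FormAt V 3) : Prop :=
  ∃ L : V ≃ₗ[ℝ] E7, σ = stdG2.compLinearMap L.toLinearMap

/-- A choice of inducing isomorphism for a positive 3-form. -/
def inducing {σ : FormAt V 3} (h : IsPositive σ) : V ≃ₗ[ℝ] E7 := h.choose

/-- The `g_σ`-orthonormal basis of `V` induced by an inducing map. -/
def bas (L : V ≃ₗ[ℝ] E7) (i : Fin 7) : V := L.symm (EuclideanSpace.single i (1 : ℝ))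

/-- The inner product induced by `g_σ` on alternating `k`-forms
(so that `e^{i₁} ∧ ⋯ ∧ e^{i_k}`, `i₁ < ⋯ < i_k`, is an orthonormal family). -/
def formInner (L : V ≃ₗ[ℝ] E7) {k : ℕ} (α β : FormAt V k) : ℝ :=
  (Nat.factorial k : ℝ)⁻¹ *
    ∑ f : Fin k → Fin 7, α (fun i => bas L (f i)) * β (fun i => bas L (f i))

/-- Wedge product of alternating forms (determinant convention). -/
def awedge {k l : ℕ} (α : FormAt V k) (β : FormAt V l) : FormAt V (k + l) :=
  ((TensorProduct.lid ℝ ℝ).toLinearMap.compAlternatingMap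
    (α.domCoprod β)).domDomCongr finSumFinEquiv

/-- The Riemannian volume form of `g_σ` (with the induced orientation). -/
def volForm (L : V ≃ₗ[ℝ] E7) : FormAt V 7 :=
  (Matrix.detRowAlternating (R := ℝ) (n := Fin 7)).compLinearMap
    ((LinearMap.pi fun i : Fin 7 => coord i) ∘ₗ L.toLinearMap)

/-- The Hodge star `*_σ : Λ³ → Λ⁴` of `g_σ`. -/
def hodge34 (L : V ≃ₗ[ℝ] E7) (α : FormAt V 3) : FormAt V 4 :=
  (6⁻¹ : ℝ) • ∑ f : Fin 3 → Fin 7,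
    α (fun i => bas L (f i)) •
      ((((volForm L).curryLeft (bas L (f 0))).curryLeft (bas L (f 1))).curryLeft
        (bas L (f 2)))

/-- The Hodge star `*_σ : Λ⁴ → Λ³` of `g_σ`. -/
def hodge43 (L : V ≃ₗ[ℝ] E7) (β : FormAt V 4) : FormAt V 3 :=
  (24⁻¹ : ℝ) • ∑ f : Fin 4 → Fin 7,
    β (fun i => bas L (f i)) •
      (((((volForm L).curryLeft (bas L (f 0))).curryLeft (bas L (f 1))).curryLeft
        (bas L (f 2))).curryLeft (bas L (f 3)))

/-- The front contraction `σ ⌐ γ : Λ¹` of a 3-form `σ` against a 4-form `γ`,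
characterized by `γ₁ ⌐ (γ₂ ⊗ α) = (γ₁·γ₂) α`. -/
def frontContr (L : V ≃ₗ[ℝ] E7) (σ : FormAt V 3) (γ : FormAt V 4) : FormAt V 1 :=
  (6⁻¹ : ℝ) • ∑ f : Fin 3 → Fin 7,
    σ (fun i => bas L (f i)) •
      (((γ.curryLeft (bas L (f 0))).curryLeft (bas L (f 1))).curryLeft (bas L (f 2)))

end G2Point

namespace G2Point

open Equiv Finset

variable {V : Type} [AddCommGroup V] [Module ℝ V]

/-- The component of a form along the basis vectors `bas L (f 0), bas L (f 1), …`. -/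
def coeff (L : V ≃ₗ[ℝ] E7) {k : ℕ} (α : FormAt V k) (f : Fin k → Fin 7) : ℝ :=
  α fun i => bas L (f i)

/-- The basis of `V` whose vectors are `bas L i`. -/
def frame (L : V ≃ₗ[ℝ] E7) : Module.Basis (Fin 7) ℝ V :=
  (EuclideanSpace.basisFun (Fin 7) ℝ).toBasis.map L.symm

lemma frame_apply (L : V ≃ₗ[ℝ] E7) (i : Fin 7) : frame L i = bas L i := by
  simp [frame, bas]

lemma ext_coeff (L : V ≃ₗ[ℝ] E7) {k : ℕ} {α β : FormAt V k}
    (h : ∀ f, Function.Injective f → coeff L α f = coeff L β f) : α = β := by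
  refine Module.Basis.ext_alternating (frame L) fun v hv => ?_
  simp only [frame_apply]
  exact h v hv

lemma coeff_add (L : V ≃ₗ[ℝ] E7) {k : ℕ} (α β : FormAt V k) (f : Fin k → Fin 7) :
    coeff L (α + β) f = coeff L α f + coeff L β f := rfl

lemma coeff_sub (L : V ≃ₗ[ℝ] E7) {k : ℕ} (α β : FormAt V k) (f : Fin k → Fin 7) :
    coeff L (α - β) f = coeff L α f - coeff L β f := rfl

lemma coeff_smul (L : V ≃ₗ[ℝ] E7) {k : ℕ} (c : ℝ) (α : FormAt V k) (f : Fin k → Fin 7) :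
    coeff L (c • α) f = c * coeff L α f := rfl

lemma coeff_sum (L : V ≃ₗ[ℝ] E7) {k : ℕ} {ι : Type} (s : Finset ι) (α : ι → FormAt V k)
    (f : Fin k → Fin 7) : coeff L (∑ i ∈ s, α i) f = ∑ i ∈ s, coeff L (α i) f :=
  map_sum (⟨⟨fun α => coeff L α f, rfl⟩, fun _ _ => rfl⟩ : FormAt V k →+ ℝ) α s

lemma coeff_perm (L : V ≃ₗ[ℝ] E7) {k : ℕ} (α : FormAt V k) (f : Fin k → Fin 7)
    (ρ : Perm (Fin k)) : coeff L α (f ∘ ρ) = ((Perm.sign ρ : ℤ) : ℝ) * coeff L α f := by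
  have := α.map_perm (fun i => bas L (f i)) ρ
  rw [Units.smul_def, zsmul_eq_mul] at this
  exact this

lemma coeff_eq_zero (L : V ≃ₗ[ℝ] E7) {k : ℕ} (α : FormAt V k) {f : Fin k → Fin 7}
    (hf : ¬ Function.Injective f) : coeff L α f = 0 :=
  α.map_eq_zero_of_not_injective _ (hf <| Function.Injective.of_comp (f := bas L) ·)

lemma sign_mul_self {k : ℕ} (ρ : Perm (Fin k)) :
    ((Perm.sign ρ : ℤ) : ℝ) * ((Perm.sign ρ : ℤ) : ℝ) = 1 := by
  rcases Int.units_eq_one_or (Perm.sign ρ) with h | h <;> simp [h]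

lemma append_comp_perm {k l : ℕ} (f : Fin k → Fin 7) (g : Fin l → Fin 7)
    (ρ : Perm (Fin k)) (τ : Perm (Fin l)) :
    Fin.append (f ∘ ρ) (g ∘ τ) =
      Fin.append f g ∘ (finSumFinEquiv.permCongr (Perm.sumCongr ρ τ)) := by
  funext i
  refine Fin.addCases (fun i => ?_) (fun i => ?_) i <;> simp [Equiv.permCongr_apply]

lemma coeff_append_perm (L : V ≃ₗ[ℝ] E7) {k l : ℕ} (ω : FormAt V (k + l))
    (f : Fin k → Fin 7) (g : Fin l → Fin 7) (ρ : Perm (Fin k)) (τ : Perm (Fin l)) :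
    coeff L ω (Fin.append (f ∘ ρ) (g ∘ τ)) =
      ((Perm.sign ρ : ℤ) : ℝ) * ((Perm.sign τ : ℤ) : ℝ) * coeff L ω (Fin.append f g) := by
  rw [append_comp_perm, coeff_perm, Perm.sign_permCongr, Perm.sign_sumCongr]
  push_cast
  ring

/-- A permutation-invariant function of tuples which is supported on the rearrangements of an
injective tuple `f` sums to `k!` times its value at `f`. -/
lemma sum_eq_factorial_mul {k : ℕ} (F : (Fin k → Fin 7) → ℝ) {f : Fin k → Fin 7}
    (hf : Function.Injective f) (hperm : ∀ ρ : Perm (Fin k), F (f ∘ ρ) = F f)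
    (hsupp : ∀ h, F h ≠ 0 → Function.Injective h ∧ ∀ i, h i ∈ Set.range f) :
    ∑ h, F h = (k.factorial : ℝ) * F f := by
  have key : ∑ ρ : Perm (Fin k), F f = ∑ h, F h := by
    refine Finset.sum_of_injOn (fun ρ : Perm (Fin k) => f ∘ ρ) ?_ (by simp) ?_ ?_
    · intro ρ _ τ _ h
      ext i
      exact congrArg Fin.val (hf (congrFun h i))
    · intro h _ hh
      by_contra hne
      obtain ⟨hinj, hrange⟩ := hsupp h hne
      choose r hr using hrange
      have hrinj : Function.Injective r := fun i j hij => hinj (by rw [← hr i, ← hr j, hij])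
      refine hh ⟨Equiv.ofBijective r (Finite.injective_iff_bijective.1 hrinj), by simp, ?_⟩
      funext i
      exact hr i
    · intro ρ _
      exact (hperm ρ).symm
  rw [← key]
  simp [Fintype.card_perm]

/-- An injective tuple can be completed to an enumeration of the frame. -/
lemma exists_append_injective {k l : ℕ} (hkl : k + l = 7) {f : Fin k → Fin 7}
    (hf : Function.Injective f) :
    ∃ g : Fin l → Fin 7, Function.Injective (Fin.append f g) := by
  classical
  have hcard : Fintype.card (Fin l) = Fintype.card {x // x ∉ Set.range f} := by
    rw [Fintype.card_subtype_compl, Set.card_range_of_injective hf]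
    simp
    omega
  let e := Fintype.equivOfCardEq hcard
  refine ⟨fun i => e i, Fin.append_injective_iff.2 ⟨hf, ?_, ?_⟩⟩
  · exact Subtype.val_injective.comp e.injective
  · intro i j h
    exact (e j).2 ⟨i, h⟩

lemma mem_range_of_append {k l : ℕ} (hkl : k + l = 7) {f : Fin k → Fin 7} {g : Fin l → Fin 7}
    (hfg : Function.Injective (Fin.append f g)) {h : Fin k → Fin 7}
    (hhg : Function.Injective (Fin.append h g)) (i : Fin k) : h i ∈ Set.range f := by
  have hsurj : Function.Surjective (Fin.append f g) :=
    ((Fintype.bijective_iff_injective_and_card _).2 ⟨hfg, by simp [hkl]⟩).2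
  obtain ⟨j, hj⟩ := hsurj (h i)
  revert hj
  refine Fin.addCases (fun j hj => ⟨j, by simpa using hj⟩) (fun j hj => ?_) j
  rw [Fin.append_right] at hj
  have := @hhg (Fin.castAdd l i) (Fin.natAdd k j) (by simp [hj])
  simp [Fin.ext_iff] at this
  omega

lemma mem_range_of_append' {k l : ℕ} (hkl : k + l = 7) {f : Fin k → Fin 7} {g : Fin l → Fin 7}
    (hfg : Function.Injective (Fin.append f g)) {h : Fin l → Fin 7}
    (hfh : Function.Injective (Fin.append f h)) (i : Fin l) : h i ∈ Set.range g := by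
  have hsurj : Function.Surjective (Fin.append f g) :=
    ((Fintype.bijective_iff_injective_and_card _).2 ⟨hfg, by simp [hkl]⟩).2
  obtain ⟨j, hj⟩ := hsurj (h i)
  revert hj
  refine Fin.addCases (fun j hj => ?_) (fun j hj => ⟨j, by simpa using hj⟩) j
  rw [Fin.append_left] at hj
  have := @hfh (Fin.castAdd l j) (Fin.natAdd k i) (by simp [hj])
  simp [Fin.ext_iff] at this
  omega

lemma sum_coeff_mul_append (L : V ≃ₗ[ℝ] E7) {k l : ℕ} (hkl : k + l = 7) (α : FormAt V k)
    (ω : FormAt V (k + l)) {f : Fin k → Fin 7} {g : Fin l → Fin 7}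
    (hfg : Function.Injective (Fin.append f g)) :
    ∑ h, coeff L α h * coeff L ω (Fin.append h g) =
      (k.factorial : ℝ) * (coeff L α f * coeff L ω (Fin.append f g)) := by
  refine sum_eq_factorial_mul (fun h => coeff L α h * coeff L ω (Fin.append h g))
    (Fin.append_injective_iff.1 hfg).1 (fun ρ => ?_) (fun h hh => ?_)
  · have := coeff_append_perm L ω f g ρ 1
    simp only [Perm.coe_one, Function.comp_id, Perm.sign_one, Units.val_one, Int.cast_one,
      mul_one] at this
    simp only [this, coeff_perm]
    linear_combination (coeff L α f * coeff L ω (Fin.append f g)) * sign_mul_self ρ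
  · have hinj : Function.Injective (Fin.append h g) := by
      by_contra hn
      exact hh (by simp [coeff_eq_zero L ω hn])
    exact ⟨(Fin.append_injective_iff.1 hinj).1, mem_range_of_append hkl hfg hinj⟩

lemma sum_append_mul_append (L : V ≃ₗ[ℝ] E7) {k l : ℕ} (hkl : k + l = 7)
    (ω : FormAt V (k + l)) {f : Fin k → Fin 7} {g : Fin l → Fin 7}
    (hfg : Function.Injective (Fin.append f g)) :
    ∑ h, coeff L ω (Fin.append f h) * coeff L ω (Fin.append f h) =
      (l.factorial : ℝ) * (coeff L ω (Fin.append f g) * coeff L ω (Fin.append f g)) := by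
  refine sum_eq_factorial_mul (fun h => coeff L ω (Fin.append f h) * coeff L ω (Fin.append f h))
    (Fin.append_injective_iff.1 hfg).2.1 (fun ρ => ?_) (fun h hh => ?_)
  · have := coeff_append_perm L ω f g 1 ρ
    simp only [Perm.coe_one, Function.comp_id, Perm.sign_one, Units.val_one, Int.cast_one,
      one_mul] at this
    simp only [this]
    linear_combination
      (coeff L ω (Fin.append f g) * coeff L ω (Fin.append f g)) * sign_mul_self ρ
  · have hinj : Function.Injective (Fin.append f h) := by
      by_contra hn
      exact hh (by simp [coeff_eq_zero L ω hn])
    exact ⟨(Fin.append_injective_iff.1 hinj).2.1, mem_range_of_append' hkl hfg hinj⟩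

/-- Contracting a form twice with a volume form recovers it up to the factor `k! l!`. -/
lemma sum_sum_coeff_mul_append (L : V ≃ₗ[ℝ] E7) {k l : ℕ} (hkl : k + l = 7) (α : FormAt V k)
    (ω : FormAt V (k + l))
    (hω : ∀ h, Function.Injective h → coeff L ω h * coeff L ω h = 1) (f : Fin k → Fin 7) :
    ∑ g : Fin l → Fin 7,
        (∑ h, coeff L α h * coeff L ω (Fin.append h g)) * coeff L ω (Fin.append f g) =
      (k.factorial : ℝ) * (l.factorial : ℝ) * coeff L α f := by
  by_cases hf : Function.Injective f
  · obtain ⟨g₀, hg₀⟩ := exists_append_injective hkl hf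
    have step : ∀ g : Fin l → Fin 7,
        (∑ h, coeff L α h * coeff L ω (Fin.append h g)) * coeff L ω (Fin.append f g) =
          (k.factorial : ℝ) * coeff L α f *
            (coeff L ω (Fin.append f g) * coeff L ω (Fin.append f g)) := by
      intro g
      by_cases hg : Function.Injective (Fin.append f g)
      · rw [sum_coeff_mul_append L hkl α ω hg]
        ring
      · simp [coeff_eq_zero L ω hg]
    rw [Finset.sum_congr rfl fun g _ => step g, ← Finset.mul_sum,
      sum_append_mul_append L hkl ω hg₀, hω _ hg₀]
    ring
  · have : ∀ g : Fin l → Fin 7, coeff L ω (Fin.append f g) = 0 := fun g =>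
      coeff_eq_zero L ω fun h => hf (Fin.append_injective_iff.1 h).1
    simp [this, coeff_eq_zero L α hf]

lemma coeff_awedge (L : V ≃ₗ[ℝ] E7) {k l : ℕ} (α : FormAt V k) (β : FormAt V l)
    (f : Fin (k + l) → Fin 7) :
    (k.factorial : ℝ) * (l.factorial : ℝ) * coeff L (awedge α β) f =
      ∑ π : Perm (Fin (k + l)), ((Perm.sign π : ℤ) : ℝ) *
        (coeff L α (fun i => f (π (Fin.castAdd l i))) *
          coeff L β (fun i => f (π (Fin.natAdd k i)))) := by
  have h := MultilinearMap.domCoprod_alternization_eq α β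
  have h2 := congrArg (fun T => TensorProduct.lid ℝ ℝ
    (T fun i => bas L (f (finSumFinEquiv i)))) h
  simp only [MultilinearMap.alternatization_apply, AlternatingMap.smul_apply, map_sum,
    Fintype.card_fin, map_nsmul] at h2
  rw [nsmul_eq_mul, Nat.cast_mul] at h2
  refine Eq.trans (Eq.trans ?_ h2.symm) ?_
  · rfl
  · refine Fintype.sum_equiv finSumFinEquiv.permCongr _ _ fun π => ?_
    rw [Perm.sign_permCongr, Units.smul_def, map_zsmul, zsmul_eq_mul]
    simp [coeff, Equiv.permCongr_apply]

lemma sum_coeff_awedge (L : V ≃ₗ[ℝ] E7) {k l : ℕ} (α : FormAt V k) (β : FormAt V l)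
    (B : (Fin (k + l) → Fin 7) → ℝ)
    (hB : ∀ f (π : Perm (Fin (k + l))), B (f ∘ π) = ((Perm.sign π : ℤ) : ℝ) * B f) :
    (k.factorial : ℝ) * (l.factorial : ℝ) * ∑ f, coeff L (awedge α β) f * B f =
      ((k + l).factorial : ℝ) *
        ∑ g, ∑ h, coeff L α g * coeff L β h * B (Fin.append g h) := by
  simp only [Finset.mul_sum, ← mul_assoc]
  simp only [coeff_awedge, Finset.sum_mul]
  rw [Finset.sum_comm]
  have step : ∀ π : Perm (Fin (k + l)),
      ∑ f, ((Perm.sign π : ℤ) : ℝ) *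
        (coeff L α (fun i => f (π (Fin.castAdd l i))) *
          coeff L β (fun i => f (π (Fin.natAdd k i)))) * B f =
      ∑ g, ∑ h, coeff L α g * coeff L β h * B (Fin.append g h) := by
    intro π
    rw [← Fintype.sum_prod_type']
    refine Fintype.sum_equiv ((π.symm.arrowCongr (Equiv.refl _)).trans
      (Fin.appendEquiv k l).symm) _ _ fun f => ?_
    have e1 : Fin.append (fun i => f (π (Fin.castAdd l i))) (fun i => f (π (Fin.natAdd k i)))
        = f ∘ π := Fin.append_castAdd_natAdd (f := f ∘ π)
    simp only [Fin.appendEquiv, Equiv.trans_apply, Equiv.coe_fn_symm_mk, Equiv.arrowCongr_apply,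
      Equiv.symm_symm, Function.comp_apply, Equiv.refl_apply]
    change _ = _ * B (Fin.append (fun i => f (π (Fin.castAdd l i)))
      (fun i => f (π (Fin.natAdd k i))))
    rw [e1, hB]
    ring
  rw [Finset.sum_congr rfl fun π _ => step π]
  simp [Fintype.card_perm, Finset.mul_sum, mul_assoc]

end G2Point

namespace G2Point

open Equiv Finset

variable {V : Type} [AddCommGroup V] [Module ℝ V]

lemma coord_single (a i : Fin 7) :
    coord a (EuclideanSpace.single i (1 : ℝ)) = ((if a = i then 1 else 0 : ℤ) : ℝ) := by
  simp [coord]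

/-- The `(a, b, c)`-minor of the rows `i, j, k` of the identity matrix. -/
def minor (a b c i j k : Fin 7) : ℤ :=
  let d : Fin 7 → Fin 7 → ℤ := fun x y => if x = y then 1 else 0
  d a i * d b j * d c k - d a i * d c j * d b k - d b i * d a j * d c k
    + d b i * d c j * d a k + d c i * d a j * d b k - d c i * d b j * d a k

/-- The components of the standard `G₂` 3-form. -/
def table (i j k : Fin 7) : ℤ :=
  minor 0 1 2 i j k + minor 0 3 4 i j k + minor 0 5 6 i j k + minor 1 3 5 i j k
    - minor 1 4 6 i j k - minor 2 3 6 i j k - minor 2 4 5 i j k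

lemma e3_single (a b c : Fin 7) (f : Fin 3 → Fin 7) :
    e3 a b c (fun i => EuclideanSpace.single (f i) (1 : ℝ)) =
      (minor a b c (f 0) (f 1) (f 2) : ℝ) := by
  have : e3 a b c (fun i => EuclideanSpace.single (f i) (1 : ℝ)) =
      Matrix.det (Matrix.of fun i j : Fin 3 =>
        ![coord a, coord b, coord c] j (EuclideanSpace.single (f i) (1 : ℝ))) := rfl
  rw [this, Matrix.det_fin_three]
  simp only [Matrix.of_apply, Matrix.cons_val_zero, Matrix.cons_val_one, Matrix.cons_val, coord_single, minor]
  push_cast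
  ring

lemma coeff_eq_table (L : V ≃ₗ[ℝ] E7) (f : Fin 3 → Fin 7) :
    coeff L (stdG2.compLinearMap L.toLinearMap) f = (table (f 0) (f 1) (f 2) : ℝ) := by
  have : coeff L (stdG2.compLinearMap L.toLinearMap) f =
      stdG2 (fun i => EuclideanSpace.single (f i) (1 : ℝ)) := by
    simp [coeff, bas]
  rw [this]
  simp only [stdG2, AlternatingMap.add_apply, AlternatingMap.sub_apply, e3_single, table]
  push_cast
  ring

lemma table_contract_left : ∀ a m : Fin 7,
    ∑ b, ∑ c, table a b c * table b c m = if a = m then 6 else 0 := by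
  decide +kernel

lemma table_contract_mid : ∀ b m : Fin 7,
    ∑ a, ∑ c, table a b c * table a c m = if b = m then -6 else 0 := by
  decide +kernel

lemma table_contract_right : ∀ c m : Fin 7,
    ∑ a, ∑ b, table a b c * table b a m = if c = m then -6 else 0 := by
  decide +kernel

lemma table_norm : ∑ a, ∑ b, ∑ c, table a b c * table a b c = 42 := by
  decide +kernel

lemma sum_fin_three (F : (Fin 3 → Fin 7) → ℝ) :
    ∑ f, F f = ∑ a, ∑ b, ∑ c, F ![a, b, c] := by
  rw [← (Fin.consEquiv fun _ => Fin 7).sum_comp, Fintype.sum_prod_type]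
  refine Finset.sum_congr rfl fun a _ => ?_
  rw [← (Fin.consEquiv fun _ => Fin 7).sum_comp, Fintype.sum_prod_type]
  refine Finset.sum_congr rfl fun b _ => ?_
  rw [← (Equiv.funUnique (Fin 1) (Fin 7)).symm.sum_comp]
  refine Finset.sum_congr rfl fun c _ => congrArg F ?_
  funext i
  fin_cases i <;> rfl

lemma coeff_volForm_id (L : V ≃ₗ[ℝ] E7) : coeff L (volForm L) id = 1 := by
  have : coeff L (volForm L) id = Matrix.det (1 : Matrix (Fin 7) (Fin 7) ℝ) := by
    refine congrArg (Matrix.det (R := ℝ) (n := Fin 7)) ?_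
    ext i j
    simp [bas, coord, Matrix.one_apply, eq_comm]
  rw [this, Matrix.det_one]

lemma coeff_volForm_mul_self (L : V ≃ₗ[ℝ] E7) (h : Fin 7 → Fin 7)
    (hh : Function.Injective h) : coeff L (volForm L) h * coeff L (volForm L) h = 1 := by
  have := coeff_perm L (volForm L) id (Equiv.ofBijective h (Finite.injective_iff_bijective.1 hh))
  rw [coeff_volForm_id, mul_one] at this
  change coeff L (volForm L) h = _ at this
  rw [this, sign_mul_self]

lemma coeff_hodge34 (L : V ≃ₗ[ℝ] E7) (α : FormAt V 3) (g : Fin 4 → Fin 7) :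
    coeff L (hodge34 L α) g =
      6⁻¹ * ∑ f : Fin 3 → Fin 7, coeff L α f * coeff L (volForm L) (Fin.append f g) := by
  simp only [hodge34, coeff_smul, coeff_sum]
  refine congrArg _ (Finset.sum_congr rfl fun f _ => congrArg _ ?_)
  refine congrArg (volForm L) ?_
  funext i
  fin_cases i <;> rfl

lemma coeff_hodge43 (L : V ≃ₗ[ℝ] E7) (β : FormAt V 4) (g : Fin 3 → Fin 7) :
    coeff L (hodge43 L β) g =
      24⁻¹ * ∑ f : Fin 4 → Fin 7, coeff L β f * coeff L (volForm L) (Fin.append f g) := by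
  simp only [hodge43, coeff_smul, coeff_sum]
  refine congrArg _ (Finset.sum_congr rfl fun f _ => congrArg _ ?_)
  refine congrArg (volForm L) ?_
  funext i
  fin_cases i <;> rfl

lemma coeff_frontContr (L : V ≃ₗ[ℝ] E7) (σ : FormAt V 3) (β : FormAt V 4) (m : Fin 1 → Fin 7) :
    coeff L (frontContr L σ β) m =
      6⁻¹ * ∑ f : Fin 3 → Fin 7, coeff L σ f * coeff L β (Fin.append f m) := by
  simp only [frontContr, coeff_smul, coeff_sum]
  refine congrArg _ (Finset.sum_congr rfl fun f _ => congrArg _ ?_)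
  refine congrArg (β) ?_
  funext i
  fin_cases i <;> rfl

lemma coeff_awedge_one (L : V ≃ₗ[ℝ] E7) (α : FormAt V 1) (β : FormAt V 3)
    (f : Fin 4 → Fin 7) :
    coeff L (awedge α β) f =
      coeff L α ![f 0] * coeff L β ![f 1, f 2, f 3]
        - coeff L α ![f 1] * coeff L β ![f 0, f 2, f 3]
        - coeff L α ![f 2] * coeff L β ![f 1, f 0, f 3]
        - coeff L α ![f 3] * coeff L β ![f 1, f 2, f 0] := by
  have h := coeff_awedge L α β f
  have h2 : ∑ π : Perm (Fin 4), ((Perm.sign π : ℤ) : ℝ) *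
        (coeff L α (fun i => f (π (Fin.castAdd 3 i))) *
          coeff L β (fun i => f (π (Fin.natAdd 1 i)))) =
      ∑ p : Fin 4, ∑ e : Perm (Fin 3), (if p = 0 then 1 else -1) *
        (coeff L α ![f p] * coeff L β (fun i => f (swap 0 p i.succ))) := by
    rw [← Equiv.Perm.decomposeFin.symm.sum_comp, Fintype.sum_prod_type]
    refine Finset.sum_congr rfl fun p _ => Finset.sum_congr rfl fun e _ => ?_
    have e1 : (fun i : Fin 1 => f (Perm.decomposeFin.symm (p, e) (Fin.castAdd 3 i))) = ![f p] := by
      funext i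
      fin_cases i
      exact congrArg f (Perm.decomposeFin_symm_apply_zero p e)
    have e2 : (fun i : Fin 3 => f (Perm.decomposeFin.symm (p, e) (Fin.natAdd 1 i))) =
        (fun i : Fin 3 => f (swap 0 p i.succ)) ∘ e := by
      funext i
      rw [show Fin.natAdd 1 i = i.succ from Fin.ext (by simp [add_comm])]
      exact congrArg f (Perm.decomposeFin_symm_apply_succ e p i)
    rw [e1, e2, coeff_perm, Perm.decomposeFin.symm_sign]
    split_ifs
    · push_cast
      linear_combination
        (coeff L α ![f p] * coeff L β fun i => f (swap 0 p i.succ)) * sign_mul_self e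
    · push_cast
      linear_combination
        -(coeff L α ![f p] * coeff L β fun i => f (swap 0 p i.succ)) * sign_mul_self e
  have h3 := h.trans h2
  simp only [Finset.sum_const, Finset.card_univ, Fintype.card_perm, Fintype.card_fin,
    Fin.sum_univ_four, Fin.isValue, nsmul_eq_mul] at h3
  have e0 : (fun i : Fin 3 => f (swap 0 0 i.succ)) = ![f 1, f 2, f 3] := by
    funext i
    fin_cases i <;> rfl
  have e1 : (fun i : Fin 3 => f (swap 0 1 i.succ)) = ![f 0, f 2, f 3] := by
    funext i
    fin_cases i <;> rfl
  have e2 : (fun i : Fin 3 => f (swap 0 2 i.succ)) = ![f 1, f 0, f 3] := by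
    funext i
    fin_cases i <;> rfl
  have e3 : (fun i : Fin 3 => f (swap 0 3 i.succ)) = ![f 1, f 2, f 0] := by
    funext i
    fin_cases i <;> rfl
  rw [e0, e1, e2, e3] at h3
  rw [if_pos trivial, if_neg (by decide), if_neg (by decide), if_neg (by decide)] at h3
  norm_num [Nat.factorial] at h3
  linarith

lemma append_assoc_three (f g : Fin 3 → Fin 7) (m : Fin 1 → Fin 7) :
    (Fin.append (Fin.append f g) m : Fin 7 → Fin 7) = Fin.append f (Fin.append g m) := by
  funext i
  fin_cases i <;> rfl

lemma coeff_swap_front (L : V ≃ₗ[ℝ] E7) (ω : FormAt V 7) (f g : Fin 3 → Fin 7)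
    (m : Fin 1 → Fin 7) :
    coeff L ω (Fin.append f (Fin.append g m)) = -coeff L ω (Fin.append g (Fin.append f m)) := by
  let ρ : Perm (Fin 7) := swap 0 3 * swap 1 4 * swap 2 5
  have h1 : (Fin.append f (Fin.append g m) : Fin 7 → Fin 7) =
      (Fin.append g (Fin.append f m) : Fin 7 → Fin 7) ∘ ρ := by
    funext i
    fin_cases i <;> rfl
  have h2 : Perm.sign ρ = -1 := by decide
  rw [h1, coeff_perm, h2]
  simp

lemma coeff_swap_back (L : V ≃ₗ[ℝ] E7) (ω : FormAt V 7) (f g : Fin 3 → Fin 7)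
    (m : Fin 1 → Fin 7) :
    coeff L ω (Fin.append (Fin.append m f) g) = -coeff L ω (Fin.append (Fin.append m g) f) := by
  let ρ : Perm (Fin 7) := swap 1 4 * swap 2 5 * swap 3 6
  have h1 : (Fin.append (Fin.append m f) g : Fin 7 → Fin 7) =
      (Fin.append (Fin.append m g) f : Fin 7 → Fin 7) ∘ ρ := by
    funext i
    fin_cases i <;> rfl
  have h2 : Perm.sign ρ = -1 := by decide
  rw [h1, coeff_perm, h2]
  simp

lemma coeff_append_comm (L : V ≃ₗ[ℝ] E7) (ω : FormAt V 7) (f : Fin 3 → Fin 7)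
    (g : Fin 4 → Fin 7) : coeff L ω (Fin.append f g) = coeff L ω (Fin.append g f) := by
  let ρ : Perm (Fin 7) := Equiv.addRight 4
  have h1 : (Fin.append f g : Fin 7 → Fin 7) = (Fin.append g f : Fin 7 → Fin 7) ∘ ρ := by
    funext i
    fin_cases i <;> rfl
  have h2 : Perm.sign ρ = 1 := by decide
  rw [h1, coeff_perm, h2]
  simp

end G2Point

namespace G2Point

open Equiv Finset

variable {V : Type} [AddCommGroup V] [Module ℝ V]

lemma hodge34_hodge43 (L : V ≃ₗ[ℝ] E7) (β : FormAt V 4) : hodge34 L (hodge43 L β) = β := by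
  refine ext_coeff L fun f _ => ?_
  rw [coeff_hodge34]
  simp only [coeff_hodge43, coeff_append_comm L (volForm L) _ f, mul_assoc]
  rw [← Finset.mul_sum]
  have := sum_sum_coeff_mul_append L (k := 4) (l := 3) rfl β (volForm L)
    (coeff_volForm_mul_self L) f
  rw [this]
  norm_num [Nat.factorial]
  ring

lemma formInner_eq (L : V ≃ₗ[ℝ] E7) (α β : FormAt V 3) :
    formInner L α β = 6⁻¹ * ∑ f, coeff L α f * coeff L β f := by
  simp [formInner, coeff, Nat.factorial]

lemma formInner_add_left (L : V ≃ₗ[ℝ] E7) (α α' β : FormAt V 3) :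
    formInner L (α + α') β = formInner L α β + formInner L α' β := by
  simp only [formInner_eq, coeff_add, add_mul, Finset.sum_add_distrib, mul_add]

lemma formInner_smul_left (L : V ≃ₗ[ℝ] E7) (c : ℝ) (α β : FormAt V 3) :
    formInner L (c • α) β = c * formInner L α β := by
  simp only [formInner_eq, coeff_smul, mul_assoc, ← Finset.mul_sum]
  ring

lemma formInner_sub_left (L : V ≃ₗ[ℝ] E7) (α α' β : FormAt V 3) :
    formInner L (α - α') β = formInner L α β - formInner L α' β := by
  simp only [formInner_eq, coeff_sub, sub_mul, Finset.sum_sub_distrib, mul_sub]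

lemma coeff_frontContr_hodge34 (L : V ≃ₗ[ℝ] E7) (σ γ : FormAt V 3) (m : Fin 1 → Fin 7) :
    coeff L (frontContr L σ (hodge34 L γ)) m =
      36⁻¹ * ∑ g, ∑ f, coeff L γ g * coeff L σ f *
        coeff L (volForm L) (Fin.append g (Fin.append f m)) := by
  rw [coeff_frontContr, Finset.sum_comm]
  simp only [coeff_hodge34, Finset.mul_sum]
  refine Finset.sum_congr rfl fun f _ => Finset.sum_congr rfl fun g _ => ?_
  ring

lemma coeff_frontContr_hodge34_eq_awedge (L : V ≃ₗ[ℝ] E7) (σ γ : FormAt V 3)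
    (m : Fin 1 → Fin 7) :
    coeff L (frontContr L σ (hodge34 L γ)) m =
      720⁻¹ * ∑ h : Fin 6 → Fin 7, coeff L (awedge γ σ) h *
        coeff L (volForm L) (Fin.append h m) := by
  have := sum_coeff_awedge L γ σ
    (fun h => coeff L (volForm L) (Fin.append h m : Fin (6 + 1) → Fin 7)) fun f π => by
      simpa using coeff_append_perm L (k := 6) (l := 1) (volForm L) f m π 1
  simp only [append_assoc_three] at this
  rw [coeff_frontContr_hodge34]
  norm_num [Nat.factorial] at this
  linarith

lemma frontContr_hodge34_add (L : V ≃ₗ[ℝ] E7) (σ γ γ' : FormAt V 3) :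
    frontContr L σ (hodge34 L (γ + γ')) =
      frontContr L σ (hodge34 L γ) + frontContr L σ (hodge34 L γ') := by
  refine ext_coeff L fun m _ => ?_
  simp only [coeff_add, coeff_frontContr_hodge34, add_mul, Finset.sum_add_distrib, mul_add]

lemma frontContr_hodge34_sub (L : V ≃ₗ[ℝ] E7) (σ γ γ' : FormAt V 3) :
    frontContr L σ (hodge34 L (γ - γ')) =
      frontContr L σ (hodge34 L γ) - frontContr L σ (hodge34 L γ') := by
  refine ext_coeff L fun m _ => ?_
  simp only [coeff_sub, coeff_frontContr_hodge34, sub_mul, Finset.sum_sub_distrib, mul_sub]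

lemma frontContr_hodge34_smul (L : V ≃ₗ[ℝ] E7) (c : ℝ) (σ γ : FormAt V 3) :
    frontContr L σ (hodge34 L (c • γ)) = c • frontContr L σ (hodge34 L γ) := by
  refine ext_coeff L fun m _ => ?_
  simp only [coeff_smul, coeff_frontContr_hodge34, mul_assoc, ← Finset.mul_sum]
  ring

lemma frontContr_hodge34_self (L : V ≃ₗ[ℝ] E7) (σ : FormAt V 3) :
    frontContr L σ (hodge34 L σ) = 0 := by
  refine ext_coeff L fun m _ => ?_
  rw [coeff_frontContr_hodge34]
  have h : ∑ g, ∑ f, coeff L σ g * coeff L σ f *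
        coeff L (volForm L) (Fin.append g (Fin.append f m)) =
      -∑ g, ∑ f, coeff L σ g * coeff L σ f *
        coeff L (volForm L) (Fin.append g (Fin.append f m)) := by
    conv_lhs => rw [Finset.sum_comm]
    simp only [← Finset.sum_neg_distrib]
    refine Finset.sum_congr rfl fun f _ => Finset.sum_congr rfl fun g _ => ?_
    rw [coeff_swap_front]
    ring
  have h0 : coeff L (0 : FormAt V 1) m = 0 := rfl
  rw [h0]
  linarith

lemma awedge_eq_zero_iff (L : V ≃ₗ[ℝ] E7) (σ γ : FormAt V 3) :
    awedge γ σ = 0 ↔ frontContr L σ (hodge34 L γ) = 0 := by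
  refine ⟨fun h => ext_coeff L fun m _ => ?_, fun h => ext_coeff L fun f hf => ?_⟩
  · rw [coeff_frontContr_hodge34_eq_awedge, h]
    simp [coeff]
  · obtain ⟨m, hm⟩ := exists_append_injective (k := 6) (l := 1) rfl hf
    have h1 := coeff_frontContr_hodge34_eq_awedge L σ γ m
    have h2 := sum_coeff_mul_append L (k := 6) (l := 1) rfl (awedge γ σ) (volForm L) hm
    rw [h2, h] at h1
    have h3 := coeff_volForm_mul_self L _ hm
    have h4 : coeff L (volForm L) (Fin.append f m) ≠ 0 := fun h0 => by simp [h0] at h3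
    have h5 : coeff L (0 : FormAt V 1) m = 0 := rfl
    rw [h5] at h1
    norm_num [Nat.factorial, h4] at h1
    exact h1

lemma coeff_awedge_hodge34 (L : V ≃ₗ[ℝ] E7) (σ γ : FormAt V 3) :
    coeff L (awedge γ (hodge34 L σ)) id = formInner L γ σ := by
  have h1 := sum_coeff_awedge L γ (hodge34 L σ) (coeff L (volForm L))
    (coeff_perm L (volForm L))
  have h2 : ∑ h : Fin 7 → Fin 7, coeff L (awedge γ (hodge34 L σ)) h * coeff L (volForm L) h =
      5040 * (coeff L (awedge γ (hodge34 L σ)) id * coeff L (volForm L) id) := by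
    refine (sum_eq_factorial_mul (fun h : Fin 7 → Fin 7 =>
      coeff L (awedge γ (hodge34 L σ)) h * coeff L (volForm L) h) (f := id)
      Function.injective_id (fun ρ => ?_) (fun h hh => ⟨?_, by simp⟩)).trans ?_
    · simp only [coeff_perm]
      linear_combination (coeff L (awedge γ (hodge34 L σ)) id * coeff L (volForm L) id) *
        sign_mul_self ρ
    · by_contra hn
      exact hh (by simp [coeff_eq_zero L (volForm L) hn])
    · norm_num [Nat.factorial]
  have h3 : ∀ g : Fin 3 → Fin 7, ∑ h : Fin 4 → Fin 7, coeff L γ g * coeff L (hodge34 L σ) h *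
      coeff L (volForm L) (Fin.append g h) = 24 * (coeff L γ g * coeff L σ g) := by
    intro g
    have := sum_sum_coeff_mul_append L (k := 3) (l := 4) rfl σ (volForm L)
      (coeff_volForm_mul_self L) g
    simp only [coeff_hodge34, mul_assoc, ← Finset.mul_sum]
    rw [this]
    norm_num [Nat.factorial]
    ring
  simp only [h3, ← Finset.mul_sum] at h1
  rw [formInner_eq]
  rw [coeff_volForm_id] at h2
  rw [show ∑ f : Fin (3 + 4) → Fin 7, _ = _ from h2] at h1
  norm_num [Nat.factorial] at h1
  linarith

lemma awedge_hodge34_eq_zero_iff (L : V ≃ₗ[ℝ] E7) (σ γ : FormAt V 3) :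
    awedge γ (hodge34 L σ) = 0 ↔ formInner L γ σ = 0 := by
  rw [← coeff_awedge_hodge34]
  refine ⟨fun h => by rw [h]; rfl, fun h => ext_coeff L fun f hf => ?_⟩
  have := coeff_perm L (awedge γ (hodge34 L σ)) id
    (Equiv.ofBijective f (Finite.injective_iff_bijective.1 hf))
  rw [h, mul_zero] at this
  exact this

lemma formInner_hodge43_awedge (L : V ≃ₗ[ℝ] E7) (α : FormAt V 1) (σ : FormAt V 3) :
    formInner L (hodge43 L (awedge α σ)) σ = 0 := by
  have h1 : ∀ f : Fin 3 → Fin 7, coeff L (hodge43 L (awedge α σ)) f =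
      6⁻¹ * ∑ m, ∑ g, coeff L α m * coeff L σ g *
        coeff L (volForm L) (Fin.append (Fin.append m g) f) := by
    intro f
    have := sum_coeff_awedge L α σ
      (fun h => coeff L (volForm L) (Fin.append h f : Fin (4 + 3) → Fin 7)) fun h π => by
        simpa using coeff_append_perm L (k := 4) (l := 3) (volForm L) h f π 1
    rw [coeff_hodge43]
    norm_num [Nat.factorial] at this
    linarith
  have h2 : ∀ m : Fin 1 → Fin 7, ∑ f, ∑ g, coeff L σ f * coeff L σ g *
        coeff L (volForm L) (Fin.append (Fin.append m g) f) = 0 := by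
    intro m
    have h : ∑ f, ∑ g, coeff L σ f * coeff L σ g *
          coeff L (volForm L) (Fin.append (Fin.append m g) f) =
        -∑ f, ∑ g, coeff L σ f * coeff L σ g *
          coeff L (volForm L) (Fin.append (Fin.append m g) f) := by
      conv_lhs => rw [Finset.sum_comm]
      simp only [← Finset.sum_neg_distrib]
      refine Finset.sum_congr rfl fun f _ => Finset.sum_congr rfl fun g _ => ?_
      rw [coeff_swap_back]
      ring
    linarith
  have h3 : ∑ f, coeff L (hodge43 L (awedge α σ)) f * coeff L σ f =
      6⁻¹ * ∑ m, coeff L α m * ∑ f, ∑ g, coeff L σ f * coeff L σ g *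
        coeff L (volForm L) (Fin.append (Fin.append m g) f) := by
    simp only [h1, Finset.mul_sum, Finset.sum_mul]
    rw [Finset.sum_comm]
    refine Finset.sum_congr rfl fun m _ => Finset.sum_congr rfl fun f _ =>
      Finset.sum_congr rfl fun g _ => ?_
    ring
  rw [formInner_eq, h3]
  simp [h2]

lemma formInner_self (L : V ≃ₗ[ℝ] E7) {σ : FormAt V 3}
    (hσ : σ = stdG2.compLinearMap L.toLinearMap) : formInner L σ σ = 7 := by
  rw [formInner_eq, hσ]
  simp only [coeff_eq_table]
  rw [sum_fin_three]
  have h : (∑ a, ∑ b, ∑ c, (table a b c : ℝ) * (table a b c : ℝ)) = 42 := by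
    exact_mod_cast table_norm
  refine (congrArg _ h).trans ?_
  norm_num

lemma frontContr_awedge (L : V ≃ₗ[ℝ] E7) {σ : FormAt V 3}
    (hσ : σ = stdG2.compLinearMap L.toLinearMap) (α : FormAt V 1) :
    frontContr L σ (awedge α σ) = (-4 : ℝ) • α := by
  refine ext_coeff L fun m _ => ?_
  have hσ' : ∀ a b c, coeff L σ ![a, b, c] = (table a b c : ℝ) := fun a b c => by
    rw [hσ, coeff_eq_table]
    rfl
  have hm : m = ![m 0] := by
    funext i
    fin_cases i
    rfl
  set F : Fin 7 → ℝ := fun a => coeff L α ![a] with hF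
  have hα : coeff L α m = F (m 0) := congrArg _ hm
  have h0 : ∀ a b c, coeff L (awedge α σ) (Fin.append (m := 3) ![a, b, c] m) =
      F a * table b c (m 0) - F b * table a c (m 0) - F c * table b a (m 0)
        - F (m 0) * table b c a := by
    intro a b c
    refine (coeff_awedge_one L α σ _).trans ?_
    simp only [← hσ']
    rfl
  have h1 : ∀ a m : Fin 7,
      (∑ b, ∑ c, (table a b c : ℝ) * table b c m) = if a = m then 6 else 0 := by
    exact_mod_cast table_contract_left
  have h2 : ∀ b m : Fin 7,
      (∑ a, ∑ c, (table a b c : ℝ) * table a c m) = if b = m then -6 else 0 := by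
    exact_mod_cast table_contract_mid
  have h3 : ∀ c m : Fin 7,
      (∑ a, ∑ b, (table a b c : ℝ) * table b a m) = if c = m then -6 else 0 := by
    exact_mod_cast table_contract_right
  have key : ∑ a, ∑ b, ∑ c, (table a b c : ℝ) *
      (F a * table b c (m 0) - F b * table a c (m 0) - F c * table b a (m 0)
        - F (m 0) * table b c a) =
      ∑ a, F a * (∑ b, ∑ c, (table a b c : ℝ) * table b c (m 0))
        - ∑ b, F b * (∑ a, ∑ c, (table a b c : ℝ) * table a c (m 0))
        - ∑ c, F c * (∑ a, ∑ b, (table a b c : ℝ) * table b a (m 0))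
        - F (m 0) * ∑ a, ∑ b, ∑ c, (table a b c : ℝ) * table b c a := by
    simp only [mul_sub, Finset.sum_sub_distrib, Finset.mul_sum]
    congr 1
    · congr 1
      · congr 1
        · simp only [mul_left_comm]
        · rw [Finset.sum_comm]
          simp only [mul_left_comm]
      · rw [Finset.sum_comm_cycle]
        simp only [mul_left_comm]
    · simp only [mul_left_comm]
  rw [coeff_frontContr, sum_fin_three]
  simp only [h0, hσ']
  rw [key]
  simp only [h1, h2, h3, coeff_smul, hα]
  simp
  ring

end G2Point

open G2Point

/-- Every 3-form `γ` decomposes uniquely as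
`γ = f⁰σ + *(f¹∧σ) + f³` with `f⁰ ∈ ℝ`, `f¹` a covector and `f³ ∈ Λ³₂₇`
(i.e. `f³∧σ = 0` and `f³∧*σ = 0`), and the components are given by
`f⁰ = (1/7) γ·σ`, `f¹ = −(1/4) σ ⌐ (*γ)` and `f³ = γ − f⁰σ − *(f¹∧σ)`. -/
theorem three_form_decomposition :
    ∀ (V : Type) [AddCommGroup V] [Module ℝ V],
      ∀ (σ : FormAt V 3) (hσ : IsPositive σ) (γ : FormAt V 3),
        (∃! p : ℝ × FormAt V 1 × FormAt V 3,
          γ = p.1 • σ + hodge43 (inducing hσ) (awedge p.2.1 σ) + p.2.2 ∧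
          awedge p.2.2 σ = 0 ∧ awedge p.2.2 (hodge34 (inducing hσ) σ) = 0) ∧
        (∀ (f0 : ℝ) (f1 : FormAt V 1) (f3 : FormAt V 3),
          γ = f0 • σ + hodge43 (inducing hσ) (awedge f1 σ) + f3 →
          awedge f3 σ = 0 → awedge f3 (hodge34 (inducing hσ) σ) = 0 →
          f0 = 7⁻¹ * formInner (inducing hσ) γ σ ∧
          f1 = -((4:ℝ)⁻¹) • frontContr (inducing hσ) σ (hodge34 (inducing hσ) γ) ∧
          f3 = γ - f0 • σ - hodge43 (inducing hσ) (awedge f1 σ)) := by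
  intro V _ _ σ hσ γ
  have hL : σ = stdG2.compLinearMap (inducing hσ).toLinearMap := hσ.choose_spec
  generalize inducing hσ = L at hL ⊢
  have hself := formInner_self L hL
  have hcontr : ∀ α : FormAt V 1,
      frontContr L σ (hodge34 L (hodge43 L (awedge α σ))) = (-4 : ℝ) • α := fun α => by
    rw [hodge34_hodge43, frontContr_awedge L hL]
  have huniq : ∀ (f0 : ℝ) (f1 : FormAt V 1) (f3 : FormAt V 3),
      γ = f0 • σ + hodge43 L (awedge f1 σ) + f3 →
      awedge f3 σ = 0 → awedge f3 (hodge34 L σ) = 0 →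
      f0 = 7⁻¹ * formInner L γ σ ∧
      f1 = -((4:ℝ)⁻¹) • frontContr L σ (hodge34 L γ) ∧
      f3 = γ - f0 • σ - hodge43 L (awedge f1 σ) := by
    intro f0 f1 f3 h hw hs
    rw [awedge_eq_zero_iff L] at hw
    rw [awedge_hodge34_eq_zero_iff] at hs
    refine ⟨?_, ?_, ?_⟩
    · rw [h, formInner_add_left, formInner_add_left, formInner_smul_left, hself,
        formInner_hodge43_awedge, hs]
      ring
    · rw [h, frontContr_hodge34_add, frontContr_hodge34_add, frontContr_hodge34_smul,
        frontContr_hodge34_self, hw, hcontr, smul_zero, zero_add, add_zero, smul_smul]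
      norm_num
    · rw [h]
      abel
  refine ⟨⟨(7⁻¹ * formInner L γ σ, -((4:ℝ)⁻¹) • frontContr L σ (hodge34 L γ),
    γ - (7⁻¹ * formInner L γ σ) • σ -
      hodge43 L (awedge (-((4:ℝ)⁻¹) • frontContr L σ (hodge34 L γ)) σ)), ⟨?_, ?_, ?_⟩, ?_⟩, huniq⟩
  · dsimp only
    abel
  · rw [awedge_eq_zero_iff L]
    dsimp only
    rw [frontContr_hodge34_sub, frontContr_hodge34_sub, frontContr_hodge34_smul,
      frontContr_hodge34_self, hcontr, smul_zero, sub_zero, smul_smul]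
    norm_num
  · rw [awedge_hodge34_eq_zero_iff]
    dsimp only
    rw [formInner_sub_left, formInner_sub_left, formInner_smul_left, hself,
      formInner_hodge43_awedge]
    ring
  · rintro ⟨f0, f1, f3⟩ ⟨h, hw, hs⟩
    dsimp only at h hw hs
    obtain ⟨h0, h1, h3⟩ := huniq f0 f1 f3 h hw hs
    rw [h0, h1] at h3
    rw [h0, h1, h3]
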